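/- For every constant δ_0 > 0 there exists a constant ζ > 0 such that, with high probability, the König process satisfies: for every integer m with (3/8) n log n ≤ m ≤ 2 n log n and every vertex set S ⊆ V with |S| ≤ n/(4 log n) in which every vertex of S has at least δ_0 log n neighbours in G_m outside of S, one has |N_{G_m}(S)| ≥ ζ |S| log n. -/

import Mathlib

open scoped Classical

noncomputable section

/-- `M` is a matching in the graph `G`: a set of edges of `G` that are pairwise disjoint. -/
def IsMatchingOn {n : ℕ} (G : SimpleGraph (Fin n)) (M : Finset (Sym2 (Fin n))) : Prop :=
  (∀ e ∈ M, e ∈ G.edgeSet) ∧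
  ∀ e ∈ M, ∀ f ∈ M, e ≠ f → ∀ v : Fin n, v ∈ e → v ∉ f

/-- ν(G): the maximum size of a matching of `G`. -/
def matchNum {n : ℕ} (G : SimpleGraph (Fin n)) : ℕ :=
  sSup {k | ∃ M : Finset (Sym2 (Fin n)), IsMatchingOn G M ∧ M.card = k}

/-- `C` is a vertex cover of `G`. -/
def IsVertexCover {n : ℕ} (G : SimpleGraph (Fin n)) (C : Finset (Fin n)) : Prop :=
  ∀ e ∈ G.edgeSet, ∃ v ∈ C, v ∈ e

/-- τ(G): the minimum size of a vertex cover of `G`. -/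
def coverNum {n : ℕ} (G : SimpleGraph (Fin n)) : ℕ :=
  sInf {k | ∃ C : Finset (Fin n), IsVertexCover G C ∧ C.card = k}

/-- `G` is a König graph: ν(G) = τ(G). -/
def IsKonig {n : ℕ} (G : SimpleGraph (Fin n)) : Prop := matchNum G = coverNum G

/-- An ordering `e_1, …, e_N` (0-indexed: `σ 0, …, σ (N-1)`) of the `N = n(n-1)/2` edges of
the complete graph on `Fin n`: an injective function from `Fin N` to non-diagonal elements
of `Sym2 (Fin n)`, hence a bijection onto the edge set of `K_n`. -/
def EdgeOrdering (n : ℕ) : Type :=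
  {σ : Fin (n*(n-1)/2) → Sym2 (Fin n) // Function.Injective σ ∧ ∀ i, ¬ (σ i).IsDiag}

/-- The König process: `KonigProc σ m` is the graph `G_m`, where `G_0 = ⊥` and
`G_{m+1} = G_m + e_{m+1}` if that graph is König, `G_{m+1} = G_m` otherwise. -/
def KonigProc {n : ℕ} (σ : EdgeOrdering n) : ℕ → SimpleGraph (Fin n)
  | 0 => ⊥
  | m+1 =>
    if h : m < n*(n-1)/2 then
      (if IsKonig (KonigProc σ m ⊔ SimpleGraph.fromEdgeSet {σ.1 ⟨m, h⟩})
        then KonigProc σ m ⊔ SimpleGraph.fromEdgeSet {σ.1 ⟨m, h⟩}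
        else KonigProc σ m)
    else KonigProc σ m

/-- The probability of an event `A` under the uniformly random edge ordering. -/
def Pr (n : ℕ) (A : EdgeOrdering n → Prop) : ℝ :=
  (Nat.card {σ : EdgeOrdering n // A σ} : ℝ) / (Nat.card (EdgeOrdering n) : ℝ)

theorem Nat.choose_mul_pow_le_pow_mul_choose {M N : ℕ} (h : M ≤ N) (r : ℕ) :
    M.choose r * N ^ r ≤ M ^ r * N.choose r := by
  have key : M.descFactorial r * N ^ r ≤ M ^ r * N.descFactorial r := by
    induction r with
    | zero => simp
    | succ r ih =>
      have hstep : (M - r) * N ≤ M * (N - r) := by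
        rw [Nat.sub_mul, Nat.mul_sub]
        have := Nat.mul_le_mul_left r h
        rw [mul_comm M r]
        omega
      rw [Nat.descFactorial_succ, Nat.descFactorial_succ, pow_succ, pow_succ]
      calc (M - r) * M.descFactorial r * (N ^ r * N)
          = ((M - r) * N) * (M.descFactorial r * N ^ r) := by ring
        _ ≤ (M * (N - r)) * (M ^ r * N.descFactorial r) := Nat.mul_le_mul hstep ih
        _ = M ^ r * M * ((N - r) * N.descFactorial r) := by ring
  rw [Nat.descFactorial_eq_factorial_mul_choose, Nat.descFactorial_eq_factorial_mul_choose] at key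
  refine le_of_mul_le_mul_left ?_ r.factorial_pos
  linarith

theorem Finset.exists_perm_map_eq {α : Type*} [Fintype α] {J K : Finset α}
    (h : J.card = K.card) : ∃ π : Equiv.Perm α, K.map π.toEmbedding = J := by
  let e : {x // x ∈ K} ≃ {x // x ∈ J} := Finset.equivOfCardEq h.symm
  refine ⟨e.extendSubtype, ?_⟩
  refine Finset.eq_of_subset_of_card_le ?_ (by simp [h])
  intro x hx
  obtain ⟨y, hy, rfl⟩ := Finset.mem_map.1 hx
  exact e.extendSubtype_mem y hy

namespace EdgeOrdering

variable {n : ℕ}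

instance : Finite (EdgeOrdering n) := by unfold EdgeOrdering; infer_instance

instance : Nonempty (EdgeOrdering n) := by
  have h : Fintype.card (Fin (n * (n - 1) / 2)) =
      Fintype.card {e : Sym2 (Fin n) // ¬ e.IsDiag} := by
    rw [Sym2.card_subtype_not_diag, Fintype.card_fin, Fintype.card_fin, Nat.choose_two_right]
  let e := Fintype.equivOfCardEq h
  exact ⟨⟨fun i => (e i).1, Subtype.val_injective.comp e.injective, fun i => (e i).2⟩⟩

/-- The set of edges that `σ` places at the positions in `I`. -/
def edgesAt (σ : EdgeOrdering n) (I : Finset (Fin (n * (n - 1) / 2))) : Finset (Sym2 (Fin n)) :=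
  I.map ⟨σ.1, σ.2.1⟩

/-- Relabelling the positions of an ordering by a permutation. -/
def permute (π : Equiv.Perm (Fin (n * (n - 1) / 2))) : EdgeOrdering n ≃ EdgeOrdering n where
  toFun σ := ⟨σ.1 ∘ π, σ.2.1.comp π.injective, fun i => σ.2.2 (π i)⟩
  invFun σ := ⟨σ.1 ∘ π.symm, σ.2.1.comp π.symm.injective, fun i => σ.2.2 (π.symm i)⟩
  left_inv σ := Subtype.ext (by ext i; simp)
  right_inv σ := Subtype.ext (by ext i; simp)

theorem edgesAt_permute (π : Equiv.Perm (Fin (n * (n - 1) / 2))) (σ : EdgeOrdering n)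
    (I : Finset (Fin (n * (n - 1) / 2))) :
    (permute π σ).edgesAt I = σ.edgesAt (I.map π.toEmbedding) := by
  rw [edgesAt, edgesAt, Finset.map_map]
  rfl

theorem edgesAt_injective (σ : EdgeOrdering n) : Function.Injective σ.edgesAt :=
  Finset.map_injective _

end EdgeOrdering

section Probability

variable {n : ℕ}

theorem Pr_mono {A B : EdgeOrdering n → Prop} (h : ∀ σ, A σ → B σ) : Pr n A ≤ Pr n B := by
  unfold Pr
  gcongr
  exact Nat.card_le_card_of_injective (Subtype.map id h)
    (Subtype.map_injective h Function.injective_id)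

theorem Pr_le_one (A : EdgeOrdering n → Prop) : Pr n A ≤ 1 := by
  unfold Pr
  refine div_le_one_of_le₀ ?_ (by positivity)
  exact_mod_cast Nat.card_le_card_of_injective _ Subtype.val_injective

theorem Pr_eq_sum [Fintype (EdgeOrdering n)] (A : EdgeOrdering n → Prop) :
    Pr n A = (∑ σ : EdgeOrdering n, if A σ then (1 : ℝ) else 0) / Nat.card (EdgeOrdering n) := by
  unfold Pr
  rw [Finset.sum_boole, Nat.card_eq_fintype_card, Fintype.card_subtype]

theorem one_le_Pr_add_Pr_not (A : EdgeOrdering n → Prop) : 1 ≤ Pr n A + Pr n (fun σ => ¬ A σ) := by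
  have := Fintype.ofFinite (EdgeOrdering n)
  have hpos : (0 : ℝ) < Nat.card (EdgeOrdering n) := by exact_mod_cast Nat.card_pos
  rw [Pr_eq_sum, Pr_eq_sum, ← add_div, le_div_iff₀ hpos, ← Finset.sum_add_distrib,
    Nat.card_eq_fintype_card, one_mul, ← Finset.card_univ, ← nsmul_one, ← Finset.sum_const]
  refine Finset.sum_le_sum fun σ _ => ?_
  by_cases h : A σ <;> simp [h]

theorem Pr_exists_le_sum {ι : Type*} (s : Finset ι) (A : ι → EdgeOrdering n → Prop) :
    Pr n (fun σ => ∃ i ∈ s, A i σ) ≤ ∑ i ∈ s, Pr n (A i) := by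
  have := Fintype.ofFinite (EdgeOrdering n)
  simp_rw [Pr_eq_sum]
  rw [← Finset.sum_div, Finset.sum_comm]
  gcongr with σ
  have hnn : ∀ i ∈ s, (0 : ℝ) ≤ if A i σ then 1 else 0 := fun i _ => by split_ifs <;> norm_num
  split_ifs with h
  · obtain ⟨i, hi, hA⟩ := h
    calc (1 : ℝ) = if A i σ then 1 else 0 := by simp [hA]
      _ ≤ _ := Finset.single_le_sum hnn hi
  · exact Finset.sum_nonneg hnn

theorem sum_Pr_le_one {ι : Type*} (s : Finset ι) (A : ι → EdgeOrdering n → Prop)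
    (hA : ∀ σ, ∀ i ∈ s, ∀ j ∈ s, A i σ → A j σ → i = j) : ∑ i ∈ s, Pr n (A i) ≤ 1 := by
  have := Fintype.ofFinite (EdgeOrdering n)
  simp_rw [Pr_eq_sum]
  rw [← Finset.sum_div, Finset.sum_comm]
  refine div_le_one_of_le₀ ?_ (by positivity)
  rw [Nat.card_eq_fintype_card, ← Finset.card_univ, ← nsmul_one, ← Finset.sum_const]
  refine Finset.sum_le_sum fun σ _ => ?_
  rw [Finset.sum_boole]
  exact_mod_cast Finset.card_le_one.2 fun i hi j hj => by
    rw [Finset.mem_filter] at hi hj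
    exact hA σ i hi.1 j hj.1 hi.2 hj.2

theorem Pr_edgesAt_eq_congr {J K : Finset (Fin (n * (n - 1) / 2))} (h : J.card = K.card)
    (A : Finset (Sym2 (Fin n))) :
    Pr n (fun σ => σ.edgesAt J = A) = Pr n (fun σ => σ.edgesAt K = A) := by
  obtain ⟨π, rfl⟩ := Finset.exists_perm_map_eq h
  unfold Pr
  congr 2
  refine Nat.card_congr ((EdgeOrdering.permute π).subtypeEquiv fun σ => ?_)
  rw [EdgeOrdering.edgesAt_permute]

theorem Pr_edgesAt_eq_mul_choose_le (J : Finset (Fin (n * (n - 1) / 2)))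
    (A : Finset (Sym2 (Fin n))) :
    Pr n (fun σ => σ.edgesAt J = A) * ((n * (n - 1) / 2).choose J.card : ℝ) ≤ 1 := by
  have h := sum_Pr_le_one (n := n) (Finset.powersetCard J.card Finset.univ)
    (fun K σ => σ.edgesAt K = A) (fun σ K _ K' _ h h' => σ.edgesAt_injective (h.trans h'.symm))
  rwa [Finset.sum_congr rfl (fun K hK => Pr_edgesAt_eq_congr (Finset.mem_powersetCard.1 hK).2 A),
    Finset.sum_const, Finset.card_powersetCard, Finset.card_univ, Fintype.card_fin, nsmul_eq_mul,
    mul_comm] at h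

/-- A fixed set of `r` edges lies in a fixed set of `M` of the `N` positions with probability
at most `(M / N) ^ r`. -/
theorem Pr_subset_edgesAt_le (I : Finset (Fin (n * (n - 1) / 2))) (A : Finset (Sym2 (Fin n))) :
    Pr n (fun σ => A ⊆ σ.edgesAt I) ≤ ((I.card : ℝ) / (n * (n - 1) / 2 : ℕ)) ^ A.card := by
  have hIN : I.card ≤ n * (n - 1) / 2 := by simpa using I.card_le_univ
  have hcover : Pr n (fun σ => A ⊆ σ.edgesAt I) ≤
      ∑ J ∈ Finset.powersetCard A.card I, Pr n (fun σ => σ.edgesAt J = A) := by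
    refine (Pr_mono fun σ h => ?_).trans (Pr_exists_le_sum _ _)
    obtain ⟨J, hJ, rfl⟩ := Finset.subset_map_iff.1 h
    exact ⟨J, Finset.mem_powersetCard.2 ⟨hJ, by simp⟩, rfl⟩
  rcases lt_or_ge I.card A.card with hlt | hle
  · rw [Finset.powersetCard_eq_empty.2 hlt, Finset.sum_empty] at hcover
    exact hcover.trans (by positivity)
  have hC : (0 : ℝ) < (n * (n - 1) / 2).choose A.card := by
    exact_mod_cast Nat.choose_pos (hle.trans hIN)
  have hbound : ∀ J ∈ Finset.powersetCard A.card I,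
      Pr n (fun σ => σ.edgesAt J = A) ≤ 1 / ((n * (n - 1) / 2).choose A.card : ℝ) := fun J hJ => by
    rw [le_div_iff₀ hC, ← (Finset.mem_powersetCard.1 hJ).2]
    exact Pr_edgesAt_eq_mul_choose_le J A
  refine (hcover.trans (Finset.sum_le_card_nsmul _ _ _ hbound)).trans ?_
  rw [Finset.card_powersetCard, nsmul_eq_mul, mul_one_div, div_pow]
  rcases Nat.eq_zero_or_pos (n * (n - 1) / 2) with h0 | hN
  · have : A.card = 0 := by omega
    simp [this]
  rw [div_le_div_iff₀ hC (by positivity)]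
  exact_mod_cast Nat.choose_mul_pow_le_pow_mul_choose hIN A.card

/-- Upper-tail bound for the number of edges of a fixed set `F` at the positions in `I`. -/
theorem Pr_le_card_inter_edgesAt (I : Finset (Fin (n * (n - 1) / 2))) (F : Finset (Sym2 (Fin n)))
    {r : ℕ} (hr : 0 < r) :
    Pr n (fun σ => r ≤ (F ∩ σ.edgesAt I).card) ≤
      (Real.exp 1 * F.card / r * (I.card / (n * (n - 1) / 2 : ℕ))) ^ r := by
  have hcover : Pr n (fun σ => r ≤ (F ∩ σ.edgesAt I).card) ≤
      ∑ A ∈ Finset.powersetCard r F, Pr n (fun σ => A ⊆ σ.edgesAt I) := by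
    refine (Pr_mono fun σ h => ?_).trans (Pr_exists_le_sum _ _)
    obtain ⟨A, hA, hcard⟩ := Finset.exists_subset_card_eq h
    exact ⟨A, Finset.mem_powersetCard.2 ⟨hA.trans Finset.inter_subset_left, hcard⟩,
      hA.trans Finset.inter_subset_right⟩
  refine (hcover.trans (Finset.sum_le_card_nsmul _ _
    (((I.card : ℝ) / (n * (n - 1) / 2 : ℕ)) ^ r) ?_)).trans ?_
  · intro A hA
    rw [← (Finset.mem_powersetCard.1 hA).2]
    exact Pr_subset_edgesAt_le I A
  rw [Finset.card_powersetCard, nsmul_eq_mul, mul_pow]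
  gcongr
  have hfac := Real.pow_div_factorial_le_exp (x := (r : ℝ)) (by positivity) r
  calc (F.card.choose r : ℝ) ≤ (F.card : ℝ) ^ r / r.factorial := Nat.choose_le_pow_div _ _
    _ = ((F.card : ℝ) ^ r / (r : ℝ) ^ r) * ((r : ℝ) ^ r / r.factorial) := by
      field_simp
    _ ≤ ((F.card : ℝ) ^ r / (r : ℝ) ^ r) * Real.exp r := by gcongr
    _ = (Real.exp 1 * F.card / r) ^ r := by
      rw [div_pow, mul_pow, ← Real.exp_nat_mul, mul_one]; ring

end Probability

theorem KonigProc_adj {n : ℕ} {σ : EdgeOrdering n} {m : ℕ} {v w : Fin n}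
    (h : (KonigProc σ m).Adj v w) : ∃ i : Fin (n * (n - 1) / 2), i.1 < m ∧ σ.1 i = s(v, w) := by
  induction m with
  | zero => simp [KonigProc] at h
  | succ m ih =>
    have old : (KonigProc σ m).Adj v w →
        ∃ i : Fin (n * (n - 1) / 2), i.1 < m + 1 ∧ σ.1 i = s(v, w) := fun h' => by
      obtain ⟨i, hi, hσ⟩ := ih h'
      exact ⟨i, by omega, hσ⟩
    unfold KonigProc at h
    split_ifs at h with hm hK
    · rw [SimpleGraph.sup_adj, SimpleGraph.fromEdgeSet_adj, Set.mem_singleton_iff] at h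
      rcases h with h | h
      · exact old h
      · exact ⟨⟨m, hm⟩, by simp, h.1.symm⟩
    · exact old h
    · exact old h

/-- All pairs with one element in `S` and the other in `T`. -/
def crossEdges {n : ℕ} (S T : Finset (Fin n)) : Finset (Sym2 (Fin n)) :=
  (S ×ˢ T).image fun p => s(p.1, p.2)

theorem card_crossEdges_le {n : ℕ} (S T : Finset (Fin n)) :
    (crossEdges S T).card ≤ S.card * T.card :=
  Finset.card_image_le.trans (Finset.card_product S T).le

theorem mul_card_le_card_crossEdges_inter {n : ℕ} (G : SimpleGraph (Fin n)) (S : Finset (Fin n))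
    (E : Finset (Sym2 (Fin n))) (hE : ∀ v w, G.Adj v w → s(v, w) ∈ E) (d : ℝ)
    (hd : ∀ v ∈ S, d ≤ ((Finset.univ.filter fun w => w ∉ S ∧ G.Adj v w).card : ℝ)) :
    d * S.card ≤ ((crossEdges S
      (Finset.univ.filter fun w => w ∉ S ∧ ∃ v ∈ S, G.Adj v w) ∩ E).card : ℝ) := by
  have hcard : d * S.card ≤
      ((S.sigma fun v => Finset.univ.filter fun w => w ∉ S ∧ G.Adj v w).card : ℝ) := by
    rw [Finset.card_sigma, mul_comm, ← nsmul_eq_mul]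
    push_cast
    exact Finset.card_nsmul_le_sum _ _ _ hd
  refine hcard.trans ?_
  norm_cast
  refine Finset.card_le_card_of_injOn (fun p => s(p.1, p.2)) ?_ ?_
  · rintro ⟨v, w⟩ hp
    simp only [Finset.coe_sigma, Set.mem_sigma_iff, Finset.mem_coe, Finset.mem_filter,
      Finset.mem_univ, true_and] at hp
    rw [Finset.mem_coe, Finset.mem_inter, crossEdges, Finset.mem_image]
    exact ⟨⟨(v, w), by simp [hp.1, hp.2.1, show ∃ v ∈ S, G.Adj v w from ⟨v, hp.1, hp.2.2⟩], rfl⟩,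
      hE v w hp.2.2⟩
  · rintro ⟨v, w⟩ hp ⟨v', w'⟩ hp' h
    simp only [Finset.coe_sigma, Set.mem_sigma_iff, Finset.mem_coe, Finset.mem_filter,
      Finset.mem_univ, true_and] at hp hp'
    rcases Sym2.eq_iff.1 h with ⟨rfl, rfl⟩ | ⟨rfl, rfl⟩
    · rfl
    · exact absurd hp.1 hp'.2.1

theorem sum_pow_card_finset (n : ℕ) (y : ℝ) :
    ∑ T : Finset (Fin n), y ^ T.card = (1 + y) ^ n := by
  have := Finset.sum_pow_mul_eq_add_pow y 1 (Finset.univ : Finset (Fin n))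
  simpa [add_comm] using this

theorem one_add_pow_le_exp_mul {y : ℝ} (hy : 0 ≤ y) (n : ℕ) : (1 + y) ^ n ≤ Real.exp (n * y) := by
  rw [Real.exp_nat_mul]
  have := Real.add_one_le_exp y
  gcongr
  linarith

theorem card_filter_card_le_le_exp (n : ℕ) {y : ℝ} (hy : 0 < y) (hy1 : y ≤ 1) :
    ((Finset.univ.filter fun T : Finset (Fin n) => (T.card : ℝ) ≤ n * y).card : ℝ) ≤
      Real.exp (n * y * (1 - Real.log y)) := by
  have h : ((Finset.univ.filter fun T : Finset (Fin n) => (T.card : ℝ) ≤ n * y).card : ℝ) *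
      Real.exp (n * y * Real.log y) ≤ Real.exp (n * y) := by
    rw [← nsmul_eq_mul]
    refine (Finset.card_nsmul_le_sum _ (fun T => y ^ T.card) _ fun T hT => ?_).trans
      ((Finset.sum_le_univ_sum_of_nonneg fun T => by positivity).trans
        ((sum_pow_card_finset n y).le.trans (one_add_pow_le_exp_mul hy.le n)))
    have hT' := (Finset.mem_filter.1 hT).2
    rw [← Real.exp_log (pow_pos hy T.card), Real.log_pow]
    exact Real.exp_le_exp.2 (mul_le_mul_of_nonpos_right hT' (Real.log_nonpos hy.le hy1))
  rwa [mul_sub, mul_one, Real.exp_sub, le_div_iff₀ (Real.exp_pos _)]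

/-- The expansion constant attached to the degree constant `δ`. -/
def expansionConst (δ : ℝ) : ℝ := min 1 (δ / (8 * Real.exp 1) * Real.exp (-3 / δ))

section Constants

variable {δ : ℝ}

theorem expansionConst_pos (hδ : 0 < δ) : 0 < expansionConst δ := by
  unfold expansionConst; positivity

theorem expansionConst_le_one : expansionConst δ ≤ 1 := min_le_left _ _

theorem mul_expansionConst_div_le (hδ : 0 < δ) :
    8 * Real.exp 1 * expansionConst δ / δ ≤ Real.exp (-3 / δ) := by
  have h : expansionConst δ ≤ δ / (8 * Real.exp 1) * Real.exp (-3 / δ) := min_le_right _ _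
  rw [div_le_iff₀ hδ]
  calc 8 * Real.exp 1 * expansionConst δ
      ≤ 8 * Real.exp 1 * (δ / (8 * Real.exp 1) * Real.exp (-3 / δ)) := by gcongr
    _ = Real.exp (-3 / δ) * δ := by field_simp

theorem mul_expansionConst_div_le_one (hδ : 0 < δ) :
    8 * Real.exp 1 * expansionConst δ / δ ≤ 1 :=
  (mul_expansionConst_div_le hδ).trans
    (Real.exp_le_one_iff.2 (div_nonpos_of_nonpos_of_nonneg (by norm_num) hδ.le))

theorem expansionConst_le (hδ : 0 < δ) : expansionConst δ ≤ δ := by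
  have h := mul_expansionConst_div_le_one hδ
  rw [div_le_one hδ] at h
  have he : 1 ≤ Real.exp 1 := Real.one_le_exp zero_le_one
  nlinarith [expansionConst_pos hδ]

theorem expansion_exponent_le (hδ : 0 < δ) {x : ℝ} (hx : 0 < x) (hx1 : x ≤ 1) :
    expansionConst δ * (1 - Real.log (expansionConst δ * x)) +
      δ * Real.log (8 * Real.exp 1 * expansionConst δ / δ * x) ≤ -2 := by
  have hζ := expansionConst_pos hδ
  have hζδ := expansionConst_le hδ
  have hq : 0 < 8 * Real.exp 1 * expansionConst δ / δ := by positivity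
  have hlogq : δ * Real.log (8 * Real.exp 1 * expansionConst δ / δ) ≤ -3 := by
    have h := Real.log_le_log hq (mul_expansionConst_div_le hδ)
    rw [Real.log_exp, le_div_iff₀ hδ] at h
    linarith
  have hlogζ : expansionConst δ * -Real.log (expansionConst δ) ≤ 1 - expansionConst δ := by
    have h := Real.one_sub_inv_le_log_of_pos hζ
    have h' := mul_le_mul_of_nonneg_left h hζ.le
    rw [mul_sub, mul_inv_cancel₀ hζ.ne'] at h'
    linarith
  have hlogx := Real.log_nonpos hx.le hx1
  rw [Real.log_mul hζ.ne' hx.ne', Real.log_mul hq.ne' hx.ne']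
  nlinarith

end Constants

/-- The positions of the first `⌊2 n log n⌋` edges. -/
def earlyPositions (n : ℕ) : Finset (Fin (n * (n - 1) / 2)) :=
  Finset.univ.filter fun i => i.1 < ⌊2 * n * Real.log n⌋₊

theorem card_earlyPositions_div_le {n : ℕ} (hn : 2 ≤ n) :
    ((earlyPositions n).card : ℝ) / (n * (n - 1) / 2 : ℕ) ≤ 8 * Real.log n / n := by
  have hn' : (2 : ℝ) ≤ n := by exact_mod_cast hn
  have hL : 0 ≤ Real.log n := Real.log_nonneg (by linarith)
  have hcard : ((earlyPositions n).card : ℝ) ≤ 2 * n * Real.log n := by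
    refine le_trans ?_ (Nat.floor_le (by positivity))
    norm_cast
    have := Finset.card_le_card_of_injOn (s := earlyPositions n)
      (t := Finset.range ⌊2 * n * Real.log n⌋₊) (fun i => i.1)
      (fun i hi => by simpa [earlyPositions] using hi) (Fin.val_injective.injOn)
    simpa using this
  have hN : ((n * (n - 1) / 2 : ℕ) : ℝ) = n * (n - 1) / 2 := by
    rw [← Nat.choose_two_right, Nat.cast_choose_two]
  rw [hN, div_le_div_iff₀ (by nlinarith) (by linarith)]
  have : 0 ≤ n * Real.log n * (n - 2) := mul_nonneg (by positivity) (by linarith)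
  nlinarith [mul_le_mul_of_nonneg_right hcard (show (0 : ℝ) ≤ n by linarith)]

theorem Pr_crossEdges_le {n : ℕ} (hn : 2 ≤ n) {δ : ℝ} (hδ : 0 < δ) {S T : Finset (Fin n)}
    (hS : S.Nonempty) (hSn : S.card * Real.log n / n ≤ 1)
    (hT : (T.card : ℝ) ≤ n * (expansionConst δ * (S.card * Real.log n / n))) :
    Pr n (fun σ => δ * Real.log n * S.card ≤
        ((crossEdges S T ∩ σ.edgesAt (earlyPositions n)).card : ℝ)) ≤
      Real.exp (S.card * Real.log n * (δ * Real.log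
        (8 * Real.exp 1 * expansionConst δ / δ * (S.card * Real.log n / n)))) := by
  have hn' : (2 : ℝ) ≤ n := by exact_mod_cast hn
  have hn0 : (0 : ℝ) < n := by linarith
  have hL : 0 < Real.log n := Real.log_pos (by linarith)
  have hs : (0 : ℝ) < S.card := by exact_mod_cast hS.card_pos
  have hζ := expansionConst_pos hδ
  have hq1 := mul_expansionConst_div_le_one hδ
  set ζ := expansionConst δ
  set L := Real.log n
  set s := (S.card : ℝ)
  have hq : 0 < 8 * Real.exp 1 * ζ / δ * (s * L / n) := by positivity
  have hq_le : 8 * Real.exp 1 * ζ / δ * (s * L / n) ≤ 1 := mul_le_one₀ hq1 (by positivity) hSn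
  have hr : δ * L * s ≤ ⌈δ * L * s⌉₊ := Nat.le_ceil _
  have hr0 : 0 < ⌈δ * L * s⌉₊ := Nat.ceil_pos.2 (by positivity)
  have hF : ((crossEdges S T).card : ℝ) ≤ s * (ζ * (s * L)) := by
    calc ((crossEdges S T).card : ℝ) ≤ ((S.card * T.card : ℕ) : ℝ) := by
          exact_mod_cast card_crossEdges_le S T
      _ = s * T.card := by push_cast; rfl
      _ ≤ s * (n * (ζ * (s * L / n))) := by gcongr
      _ = s * (ζ * (s * L)) := by field_simp
  refine (Pr_mono fun σ h => Nat.ceil_le.2 h).trans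
    ((Pr_le_card_inter_edgesAt _ _ hr0).trans ?_)
  have hbase : Real.exp 1 * (crossEdges S T).card / ⌈δ * L * s⌉₊ *
      ((earlyPositions n).card / (n * (n - 1) / 2 : ℕ)) ≤
      8 * Real.exp 1 * ζ / δ * (s * L / n) := by
    calc _ ≤ Real.exp 1 * (s * (ζ * (s * L))) / (δ * L * s) * (8 * L / n) := by
          refine mul_le_mul ?_ (card_earlyPositions_div_le hn) (by positivity) (by positivity)
          gcongr
      _ = 8 * Real.exp 1 * ζ / δ * (s * L / n) := by field_simp
  calc _ ≤ (8 * Real.exp 1 * ζ / δ * (s * L / n)) ^ ⌈δ * L * s⌉₊ := by gcongr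
    _ = Real.exp (⌈δ * L * s⌉₊ * Real.log (8 * Real.exp 1 * ζ / δ * (s * L / n))) := by
      rw [Real.exp_nat_mul, Real.exp_log hq]
    _ ≤ Real.exp (δ * L * s * Real.log (8 * Real.exp 1 * ζ / δ * (s * L / n))) :=
      Real.exp_le_exp.2 (mul_le_mul_of_nonpos_right hr (Real.log_nonpos hq.le hq_le))
    _ = _ := by congr 1; ring

theorem Pr_exists_crossEdges_le {n : ℕ} (hn : 2 ≤ n) {δ : ℝ} (hδ : 0 < δ) {S : Finset (Fin n)}
    (hS : S.Nonempty) (hSn : S.card * Real.log n / n ≤ 1) :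
    Pr n (fun σ => ∃ T ∈ Finset.univ.filter fun T : Finset (Fin n) =>
          (T.card : ℝ) ≤ n * (expansionConst δ * (S.card * Real.log n / n)),
        δ * Real.log n * S.card ≤
          ((crossEdges S T ∩ σ.edgesAt (earlyPositions n)).card : ℝ)) ≤
      (((n : ℝ) ^ 2)⁻¹) ^ S.card := by
  have hn' : (2 : ℝ) ≤ n := by exact_mod_cast hn
  have hn0 : (0 : ℝ) < n := by linarith
  have hL : 0 < Real.log n := Real.log_pos (by linarith)
  have hs : (0 : ℝ) < S.card := by exact_mod_cast hS.card_pos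
  have hζ := expansionConst_pos hδ
  have hx : 0 < S.card * Real.log n / n := by positivity
  refine (Pr_exists_le_sum _ _).trans ((Finset.sum_le_card_nsmul _ _ _ fun T hT =>
    Pr_crossEdges_le hn hδ hS hSn (Finset.mem_filter.1 hT).2).trans ?_)
  rw [nsmul_eq_mul]
  refine (mul_le_mul_of_nonneg_right (card_filter_card_le_le_exp n (mul_pos hζ hx)
    (mul_le_one₀ expansionConst_le_one hx.le hSn)) (Real.exp_pos _).le).trans ?_
  have hpow : (((n : ℝ) ^ 2)⁻¹) ^ S.card = Real.exp (S.card * Real.log n * -2) := by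
    rw [← Real.exp_log (pow_pos (inv_pos.2 (pow_pos hn0 2)) _), Real.log_pow, Real.log_inv,
      Real.log_pow]
    congr 1; push_cast; ring
  rw [← Real.exp_add, hpow, Real.exp_le_exp]
  have hny : n * (expansionConst δ * (S.card * Real.log n / n)) =
      S.card * Real.log n * expansionConst δ := by field_simp
  rw [hny, mul_assoc (_ * _) (expansionConst δ), ← mul_add]
  exact mul_le_mul_of_nonneg_left (expansion_exponent_le hδ hx hSn) (by positivity)

/-- For every `δ₀ > 0` there is `ζ > 0` such that whp, for every
`(3/8) n log n ≤ m ≤ 2 n log n` and every `S` with `|S| ≤ n/(4 log n)` in which every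
vertex has at least `δ₀ log n` neighbours outside `S` in `G_m`, one has
`|N_{G_m}(S)| ≥ ζ |S| log n`. -/
theorem koenig_process_super_expansion (δ₀ : ℝ) (hδ₀ : 0 < δ₀) :
    ∃ ζ : ℝ, 0 < ζ ∧
      Filter.Tendsto (fun k : ℕ =>
        Pr (2*k) (fun σ =>
          let n : ℕ := 2*k
          ∀ m : ℕ, (3 : ℝ)/8 * n * Real.log n ≤ (m : ℝ) → (m : ℝ) ≤ 2 * n * Real.log n →
            ∀ S : Finset (Fin n), (S.card : ℝ) ≤ n / (4 * Real.log n) →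
              (∀ v ∈ S, δ₀ * Real.log n ≤
                ((Finset.univ.filter
                    (fun w => w ∉ S ∧ (KonigProc σ m).Adj v w)).card : ℝ)) →
              ζ * S.card * Real.log n ≤
                ((Finset.univ.filter
                    (fun w => w ∉ S ∧ ∃ v ∈ S, (KonigProc σ m).Adj v w)).card : ℝ)))
        Filter.atTop (nhds 1) := by
  refine ⟨expansionConst δ₀, expansionConst_pos hδ₀, ?_⟩
  have hlim : Filter.Tendsto (fun k : ℕ => 2 - Real.exp (((2 * k : ℕ) : ℝ)⁻¹))
      Filter.atTop (nhds 1) := by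
    have h2k : Filter.Tendsto (fun k : ℕ => ((2 * k : ℕ) : ℝ)⁻¹) Filter.atTop (nhds 0) :=
      tendsto_inv_atTop_zero.comp (tendsto_natCast_atTop_atTop.comp
        (Filter.tendsto_id.const_mul_atTop' two_pos))
    have h := ((Real.continuous_exp.tendsto 0).comp h2k).const_sub 2
    rw [Real.exp_zero] at h
    norm_num at h
    simpa [Function.comp_def] using h
  refine tendsto_of_tendsto_of_tendsto_of_le_of_le' hlim tendsto_const_nhds ?_
    (Filter.Eventually.of_forall fun k => Pr_le_one _)
  filter_upwards [Filter.eventually_ge_atTop 1] with k hk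
  have hn : 2 ≤ 2 * k := by omega
  generalize 2 * k = n at hn
  have hn' : (2 : ℝ) ≤ n := by exact_mod_cast hn
  have hn0 : (0 : ℝ) < n := by linarith
  have hL : 0 < Real.log n := Real.log_pos (by linarith)
  refine le_trans ?_ (sub_le_iff_le_add.2 (one_le_Pr_add_Pr_not _))
  suffices h : Pr n (fun σ => ∃ S ∈ Finset.univ.filter fun S : Finset (Fin n) =>
        S.Nonempty ∧ S.card * Real.log n / n ≤ 1,
      ∃ T ∈ Finset.univ.filter fun T : Finset (Fin n) =>
          (T.card : ℝ) ≤ n * (expansionConst δ₀ * (S.card * Real.log n / n)),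
        δ₀ * Real.log n * S.card ≤
          ((crossEdges S T ∩ σ.edgesAt (earlyPositions n)).card : ℝ)) ≤
      Real.exp ((n : ℝ)⁻¹) - 1 by
    refine le_sub_comm.2 (((Pr_mono fun σ hσ => ?_).trans h).trans (le_of_eq (by ring)))
    dsimp only at hσ
    push Not at hσ
    obtain ⟨m, -, hm, S, hS, hdeg, hlt⟩ := hσ
    have hSne : S.Nonempty := by
      rw [Finset.nonempty_iff_ne_empty]
      rintro rfl
      simp at hlt
    refine ⟨S, Finset.mem_filter.2 ⟨Finset.mem_univ _, hSne, ?_⟩, _,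
      Finset.mem_filter.2 ⟨Finset.mem_univ _, ?_⟩,
      mul_card_le_card_crossEdges_inter (KonigProc σ m) S _ (fun v w hvw => ?_) _ hdeg⟩
    · rw [le_div_iff₀ (by positivity)] at hS
      rw [div_le_one hn0]
      nlinarith [mul_nonneg (Nat.cast_nonneg (α := ℝ) S.card) hL.le]
    · refine hlt.le.trans (le_of_eq ?_)
      field_simp
    · obtain ⟨i, hi, hσi⟩ := KonigProc_adj hvw
      refine Finset.mem_map.2 ⟨i, ?_, hσi⟩
      exact Finset.mem_filter.2 ⟨Finset.mem_univ _, hi.trans_le (Nat.le_floor hm)⟩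
  refine (Pr_exists_le_sum _ _).trans ((Finset.sum_le_sum fun S hS =>
    Pr_exists_crossEdges_le hn hδ₀ (Finset.mem_filter.1 hS).2.1
      (Finset.mem_filter.1 hS).2.2).trans ?_)
  have hz : (0 : ℝ) ≤ ((n : ℝ) ^ 2)⁻¹ := by positivity
  have hsub : (Finset.univ.filter fun S : Finset (Fin n) =>
      S.Nonempty ∧ S.card * Real.log n / n ≤ 1) ⊆ Finset.univ.erase ∅ := fun S hS =>
    Finset.mem_erase.2 ⟨(Finset.mem_filter.1 hS).2.1.ne_empty, Finset.mem_univ _⟩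
  refine (Finset.sum_le_sum_of_subset_of_nonneg hsub fun S _ _ => by positivity).trans ?_
  rw [Finset.sum_erase_eq_sub (Finset.mem_univ _), sum_pow_card_finset, Finset.card_empty,
    pow_zero]
  refine sub_le_sub_right ((one_add_pow_le_exp_mul hz n).trans (le_of_eq ?_)) 1
  congr 1
  field_simp
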